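/- The minimax risk of missing mass estimation satisfies liminf_{n→∞} n·R*_n ≥ 4/27. -/

import Mathlib

open scoped BigOperators

noncomputable section

/-- `p` is a probability mass function on `ℕ`. -/
def IsPMF (p : ℕ → ℝ) : Prop := (∀ u, 0 ≤ p u) ∧ HasSum p 1

/-- `N_u(X^n)`: the number of appearances of the symbol `u` in the sample `x`. -/
def nOcc {n : ℕ} (x : Fin n → ℕ) (u : ℕ) : ℕ :=
  (Finset.univ.filter fun i => x i = u).card

/-- Probability of the sample `x` under the `n`-fold product measure `p^⊗n`. -/
def sampleProb {n : ℕ} (p : ℕ → ℝ) (x : Fin n → ℕ) : ℝ := ∏ i, p (x i)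

/-- Expectation of `f(X^n)` for `X^n ∼ p^⊗n`. -/
def expct (n : ℕ) (p : ℕ → ℝ) (f : (Fin n → ℕ) → ℝ) : ℝ :=
  ∑' x : Fin n → ℕ, sampleProb p x * f x

/-- The missing mass `M₀(X^n) = ∑_u p(u) 𝟙[N_u(X^n) = 0]`. -/
def missingMass {n : ℕ} (p : ℕ → ℝ) (x : Fin n → ℕ) : ℝ :=
  ∑' u : ℕ, if nOcc x u = 0 then p u else 0

/-- `Φ_i(X^n)`: the number of symbols appearing exactly `i` times in `x` (for `i ≥ 1`). -/
def phi {n : ℕ} (i : ℕ) (x : Fin n → ℕ) : ℕ :=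
  ((Finset.univ.image x).filter fun u => nOcc x u = i).card

/-- The Good-Turing estimator `M^GT(X^n) = Φ₁(X^n)/n`. -/
def goodTuring {n : ℕ} (x : Fin n → ℕ) : ℝ := (phi 1 x : ℝ) / n

/-- The squared-error risk `R_n(M̂, p) = E[(M̂(X^n) - M₀(X^n))²]`. -/
def risk (n : ℕ) (p : ℕ → ℝ) (M : (Fin n → ℕ) → ℝ) : ℝ :=
  expct n p fun x => (M x - missingMass p x) ^ 2

/-- The worst-case risk of the Good-Turing estimator, `sup_p R_n(M^GT, p)`. -/
def gtWorstRisk (n : ℕ) : ℝ :=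
  sSup {r : ℝ | ∃ p : ℕ → ℝ, IsPMF p ∧ r = risk n p goodTuring}

/-- The minimax risk `R*_n = inf_{M̂} sup_p R_n(M̂, p)`, the infimum over all
estimators `M̂ : ℕ^n → [0,1]` of the worst-case risk over all pmfs `p` on `ℕ`. -/
def minimaxRisk (n : ℕ) : ℝ :=
  sInf {r : ℝ | ∃ M : (Fin n → ℕ) → ℝ, (∀ x, M x ∈ Set.Icc (0 : ℝ) 1) ∧
    r = sSup {s : ℝ | ∃ p : ℕ → ℝ, IsPMF p ∧ s = risk n p M}}

open MeasureTheory Filter Topology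

/-- The `PMF` on `ℕ` with masses `p`. -/
def IsPMF.toPMF {p : ℕ → ℝ} (hp : IsPMF p) : PMF ℕ :=
  ⟨fun u => ENNReal.ofReal (p u), by
    have h := ENNReal.summable (f := fun u => ENNReal.ofReal (p u)) |>.hasSum
    rwa [← ENNReal.ofReal_tsum_of_nonneg hp.1 hp.2.summable, hp.2.tsum_eq, ENNReal.ofReal_one] at h⟩

/-- The law of `n` i.i.d. samples from `p`, as a measure. -/
def IsPMF.sampleLaw {p : ℕ → ℝ} (hp : IsPMF p) (n : ℕ) : Measure (Fin n → ℕ) :=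
  Measure.pi fun _ => hp.toPMF.toMeasure

instance {p : ℕ → ℝ} (hp : IsPMF p) (n : ℕ) : IsProbabilityMeasure (hp.sampleLaw n) := by
  unfold IsPMF.sampleLaw; infer_instance

namespace IsPMF

variable {p : ℕ → ℝ} (hp : IsPMF p)

include hp in
lemma sum_le_one (s : Finset ℕ) : ∑ u ∈ s, p u ≤ 1 := sum_le_hasSum s (fun u _ => hp.1 u) hp.2

include hp in
lemma le_one (u : ℕ) : p u ≤ 1 := by simpa using hp.sum_le_one {u}

lemma toMeasure_real_singleton (u : ℕ) : hp.toPMF.toMeasure.real {u} = p u := by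
  rw [measureReal_def, PMF.toMeasure_apply_singleton _ _ (measurableSet_singleton u)]
  exact ENNReal.toReal_ofReal (hp.1 u)

lemma sampleLaw_real_singleton {n : ℕ} (x : Fin n → ℕ) :
    (hp.sampleLaw n).real {x} = sampleProb p x := by
  rw [sampleLaw, measureReal_def, Measure.pi_singleton, ENNReal.toReal_prod]
  exact Finset.prod_congr rfl fun i _ => hp.toMeasure_real_singleton (x i)

lemma integrable_of_bounded {n : ℕ} {f : (Fin n → ℕ) → ℝ} {C : ℝ} (hf : ∀ x, |f x| ≤ C) :
    Integrable f (hp.sampleLaw n) :=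
  Integrable.of_bound (measurable_of_countable f).aestronglyMeasurable C
    (Eventually.of_forall hf)

lemma expct_eq_integral {n : ℕ} {f : (Fin n → ℕ) → ℝ} {C : ℝ} (hf : ∀ x, |f x| ≤ C) :
    expct n p f = ∫ x, f x ∂hp.sampleLaw n := by
  rw [integral_countable (hp.integrable_of_bounded hf)]
  exact tsum_congr fun x => by rw [hp.sampleLaw_real_singleton, smul_eq_mul]

lemma integral_prod {n : ℕ} (g : Fin n → ℕ → ℝ) :
    ∫ x, ∏ i, g i (x i) ∂hp.sampleLaw n = ∏ i, ∫ y, g i y ∂hp.toPMF.toMeasure :=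
  integral_fintype_prod_eq_prod _

lemma integral_atom (u : ℕ) :
    ∫ y, (if y = u then (1 : ℝ) else 0) ∂hp.toPMF.toMeasure = p u := by
  have : (fun y : ℕ => if y = u then (1 : ℝ) else 0) = Set.indicator {u} 1 := by
    ext y; simp [Set.indicator_apply]
  rw [this, integral_indicator_one (measurableSet_singleton u), hp.toMeasure_real_singleton]

lemma integrable_atom (u : ℕ) :
    Integrable (fun y : ℕ => if y = u then (1 : ℝ) else 0) hp.toPMF.toMeasure :=
  Integrable.of_bound (measurable_of_countable _).aestronglyMeasurable 1
    (Eventually.of_forall fun y => by split_ifs <;> simp)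

lemma integral_avoid {u v : ℕ} (huv : u ≠ v) :
    ∫ y, (if y = u ∨ y = v then (0 : ℝ) else 1) ∂hp.toPMF.toMeasure = 1 - p u - p v := by
  have : (fun y : ℕ => if y = u ∨ y = v then (0 : ℝ) else 1) =
      fun y => 1 - (if y = u then 1 else 0) - (if y = v then 1 else 0) := by
    ext y
    by_cases h : y = u
    · subst h; simp [huv]
    · by_cases h' : y = v
      · subst h'; simp [h]
      · simp [h, h']
  have hint : Integrable (fun y : ℕ => 1 - if y = u then (1 : ℝ) else 0) hp.toPMF.toMeasure :=
    (integrable_const _).sub (hp.integrable_atom u)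
  rw [this, integral_sub hint (hp.integrable_atom v), integral_sub (integrable_const _) (hp.integrable_atom u), hp.integral_atom, hp.integral_atom]
  simp

lemma integral_nOcc_eq_zero {n : ℕ} (u : ℕ) :
    ∫ x, (if nOcc x u = 0 then (1 : ℝ) else 0) ∂hp.sampleLaw n = (1 - p u) ^ n := by
  have h : ∀ x : Fin n → ℕ, (if nOcc x u = 0 then (1 : ℝ) else 0) =
      ∏ i, (1 - if x i = u then (1 : ℝ) else 0) := by
    intro x
    split_ifs with h
    · rw [nOcc, Finset.card_eq_zero, Finset.filter_eq_empty_iff] at h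
      exact (Finset.prod_eq_one fun i _ => by simp [h (Finset.mem_univ i)]).symm
    · rw [nOcc, Finset.card_eq_zero, Finset.filter_eq_empty_iff] at h
      push Not at h
      obtain ⟨i, hi, h⟩ := h
      exact (Finset.prod_eq_zero hi (by simp [h])).symm
  simp_rw [h]
  rw [hp.integral_prod fun _ y => 1 - if y = u then (1 : ℝ) else 0]
  rw [integral_sub (integrable_const _) (hp.integrable_atom u), hp.integral_atom]
  simp

lemma integral_nOcc_eq_one_le {n : ℕ} (u : ℕ) :
    ∫ x, (if nOcc x u = 1 then (1 : ℝ) else 0) ∂hp.sampleLaw n ≤ n * p u := by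
  have h : ∀ x : Fin n → ℕ, (if nOcc x u = 1 then (1 : ℝ) else 0) ≤
      ∑ i, ∏ j, (if j = i then if x j = u then (1 : ℝ) else 0 else 1) := by
    intro x
    simp only [Finset.prod_ite_eq', Finset.mem_univ, if_true, Finset.sum_boole]
    change _ ≤ (nOcc x u : ℝ)
    split_ifs with h <;> simp [h]
  have hint : ∀ i : Fin n, Integrable
      (fun x : Fin n → ℕ => ∏ j, (if j = i then if x j = u then (1 : ℝ) else 0 else 1))
      (hp.sampleLaw n) := fun i => hp.integrable_of_bounded (C := 1) fun x => by
    simp only [Finset.prod_ite_eq', Finset.mem_univ, if_true]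
    split_ifs <;> simp
  refine (integral_mono (hp.integrable_of_bounded (C := 1) fun x => by split_ifs <;> simp)
    (integrable_finsetSum _ fun i _ => hint i) h).trans ?_
  rw [integral_finsetSum _ fun i _ => hint i]
  have : ∀ i : Fin n, ∫ x, ∏ j, (if j = i then if x j = u then (1 : ℝ) else 0 else 1)
      ∂hp.sampleLaw n = p u := by
    intro i
    rw [hp.integral_prod fun j y => if j = i then if y = u then (1 : ℝ) else 0 else 1]
    rw [Finset.prod_eq_single i]
    · simp only [if_true, hp.integral_atom]
    · intro j _ hj; simp [hj]
    · simp
  rw [Finset.sum_congr rfl fun i _ => this i]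
  simp

end IsPMF

lemma nOcc_eq_zero_iff {n : ℕ} {x : Fin n → ℕ} {u : ℕ} : nOcc x u = 0 ↔ ∀ i, x i ≠ u := by
  simp [nOcc, Finset.filter_eq_empty_iff]

lemma nOcc_eq_one_iff {n : ℕ} {x : Fin n → ℕ} {u : ℕ} :
    nOcc x u = 1 ↔ ∃ i, x i = u ∧ ∀ j, j ≠ i → x j ≠ u := by
  rw [nOcc, Finset.card_eq_one]
  constructor
  · rintro ⟨i, hi⟩
    have h : ∀ j, x j = u ↔ j = i := fun j => by simpa using Finset.ext_iff.1 hi j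
    exact ⟨i, (h i).2 rfl, fun j hj hju => hj ((h j).1 hju)⟩
  · rintro ⟨i, hi, h⟩
    refine ⟨i, Finset.ext fun j => ?_⟩
    simp only [Finset.mem_filter, Finset.mem_univ, true_and, Finset.mem_singleton]
    exact ⟨fun hj => by_contra fun hji => h j hji hj, fun hj => hj ▸ hi⟩

namespace IsPMF

variable {p : ℕ → ℝ} (hp : IsPMF p)

lemma integral_nOcc_zero_zero {n : ℕ} {u v : ℕ} (huv : u ≠ v) :
    ∫ x, (if nOcc x u = 0 ∧ nOcc x v = 0 then (1 : ℝ) else 0) ∂hp.sampleLaw n =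
      (1 - p u - p v) ^ n := by
  have h : ∀ x : Fin n → ℕ, (if nOcc x u = 0 ∧ nOcc x v = 0 then (1 : ℝ) else 0) =
      ∏ i, (if x i = u ∨ x i = v then (0 : ℝ) else 1) := by
    intro x
    simp_rw [nOcc_eq_zero_iff]
    split_ifs with h
    · exact (Finset.prod_eq_one fun i _ => by simp [h.1 i, h.2 i]).symm
    · have : ∃ i, x i = u ∨ x i = v := by
        by_contra! hc
        exact h ⟨fun i => (hc i).1, fun i => (hc i).2⟩
      obtain ⟨i, hi⟩ := this
      exact (Finset.prod_eq_zero (Finset.mem_univ i) (by simp [hi])).symm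
  simp_rw [h]
  rw [hp.integral_prod fun _ y => if y = u ∨ y = v then (0 : ℝ) else 1]
  simp [hp.integral_avoid huv]

/-- The probability of seeing `v` exactly once and `u` never, from below. -/
lemma le_integral_nOcc_zero_one {n : ℕ} {u v : ℕ} (huv : u ≠ v) :
    n * (p v * (1 - p u - p v) ^ (n - 1)) ≤
      ∫ x, (if nOcc x u = 0 ∧ nOcc x v = 1 then (1 : ℝ) else 0) ∂hp.sampleLaw n := by
  let T : Fin n → (Fin n → ℕ) → ℝ := fun i x =>
    ∏ j, (if j = i then if x j = v then (1 : ℝ) else 0 else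
      if x j = u ∨ x j = v then (0 : ℝ) else 1)
  have hT : ∀ i x, T i x = if x i = v ∧ ∀ j, j ≠ i → x j ≠ u ∧ x j ≠ v then 1 else 0 := by
    intro i x
    split_ifs with h
    · refine Finset.prod_eq_one fun j _ => ?_
      by_cases hj : j = i
      · subst hj; simp [h.1]
      · simp [hj, h.2 j hj]
    · by_cases hi : x i = v
      · have : ∃ j, j ≠ i ∧ (x j = u ∨ x j = v) := by
          by_contra! hc
          exact h ⟨hi, hc⟩
        obtain ⟨j, hj, hc⟩ := this
        exact Finset.prod_eq_zero (Finset.mem_univ j) (by simp [hj, hc])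
      · exact Finset.prod_eq_zero (Finset.mem_univ i) (by simp [hi])
  have hint : ∀ i, Integrable (T i) (hp.sampleLaw n) := fun i =>
    hp.integrable_of_bounded (C := 1) fun x => by rw [hT]; split_ifs <;> simp
  have hval : ∀ i, ∫ x, T i x ∂hp.sampleLaw n = p v * (1 - p u - p v) ^ (n - 1) := by
    intro i
    rw [hp.integral_prod fun j y => if j = i then if y = v then (1 : ℝ) else 0 else
      if y = u ∨ y = v then (0 : ℝ) else 1]
    rw [← Finset.mul_prod_erase _ _ (Finset.mem_univ i)]
    simp only [if_true, hp.integral_atom]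
    congr 1
    rw [Finset.prod_congr (g := fun _ => 1 - p u - p v) rfl fun j hj => by
      simp only [Finset.ne_of_mem_erase hj, if_false, hp.integral_avoid huv]]
    simp [Finset.card_erase_of_mem]
  have hle : ∀ x, ∑ i, T i x ≤ if nOcc x u = 0 ∧ nOcc x v = 1 then (1 : ℝ) else 0 := by
    intro x
    by_cases hx : ∃ i, x i = v ∧ ∀ j, j ≠ i → x j ≠ u ∧ x j ≠ v
    · obtain ⟨i, hi, h⟩ := hx
      rw [Finset.sum_eq_single i]
      · have h0 : nOcc x u = 0 := nOcc_eq_zero_iff.2 fun j => by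
          by_cases hj : j = i
          · rw [hj, hi]; exact huv.symm
          · exact (h j hj).1
        have h1 : nOcc x v = 1 := nOcc_eq_one_iff.2 ⟨i, hi, fun j hj => (h j hj).2⟩
        rw [if_pos ⟨h0, h1⟩, hT]
        split_ifs <;> simp
      · intro j _ hj
        rw [hT, if_neg fun hc => (h j hj).2 hc.1]
      · simp
    · rw [Finset.sum_eq_zero fun i _ => by rw [hT, if_neg fun hc => hx ⟨i, hc⟩]]
      split_ifs <;> simp
  have := integral_mono (integrable_finsetSum _ fun i _ => hint i)
    (hp.integrable_of_bounded (C := 1) fun x => by split_ifs <;> simp) hle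
  rw [integral_finsetSum _ fun i _ => hint i, Finset.sum_congr rfl fun i _ => hval i] at this
  simpa using this

/-- The probability of seeing both `u` and `v` exactly once, from above. -/
lemma integral_nOcc_one_one_le {n : ℕ} {u v : ℕ} (huv : u ≠ v) :
    ∫ x, (if nOcc x u = 1 ∧ nOcc x v = 1 then (1 : ℝ) else 0) ∂hp.sampleLaw n ≤
      n * ((n - 1 : ℕ) * (p u * p v * (1 - p u - p v) ^ (n - 2))) := by
  let T : Fin n → Fin n → (Fin n → ℕ) → ℝ := fun i k x =>
    ∏ j, (if j = i then if x j = u then (1 : ℝ) else 0 else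
      if j = k then if x j = v then (1 : ℝ) else 0 else
      if x j = u ∨ x j = v then (0 : ℝ) else 1)
  have hT0 : ∀ i k x, 0 ≤ T i k x := fun i k x => Finset.prod_nonneg fun j _ => by
    split_ifs <;> simp
  have hT1 : ∀ i k x, T i k x ≤ 1 := fun i k x => Finset.prod_le_one (fun j _ => by
    split_ifs <;> simp) fun j _ => by split_ifs <;> simp
  have hint : ∀ i k, Integrable (T i k) (hp.sampleLaw n) := fun i k =>
    hp.integrable_of_bounded (C := 1) fun x => abs_le.2 ⟨by linarith [hT0 i k x], hT1 i k x⟩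
  have hval : ∀ i, ∀ k ∈ Finset.univ.erase i, ∫ x, T i k x ∂hp.sampleLaw n =
      p u * p v * (1 - p u - p v) ^ (n - 2) := by
    intro i k hk
    rw [hp.integral_prod fun j y => if j = i then if y = u then (1 : ℝ) else 0 else
      if j = k then if y = v then (1 : ℝ) else 0 else
      if y = u ∨ y = v then (0 : ℝ) else 1]
    rw [← Finset.mul_prod_erase _ _ (Finset.mem_univ i), ← Finset.mul_prod_erase _ _ hk]
    simp only [if_true, hp.integral_atom, Finset.ne_of_mem_erase hk, if_false, mul_assoc]
    congr 2
    rw [Finset.prod_congr (g := fun _ => 1 - p u - p v) rfl fun j hj => by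
      simp only [Finset.ne_of_mem_erase hj, Finset.ne_of_mem_erase (Finset.mem_of_mem_erase hj),
        if_false, hp.integral_avoid huv]]
    rw [Finset.prod_const, Finset.card_erase_of_mem hk]
    simp [Nat.sub_sub]
  have hle : ∀ x, (if nOcc x u = 1 ∧ nOcc x v = 1 then (1 : ℝ) else 0) ≤
      ∑ i, ∑ k ∈ Finset.univ.erase i, T i k x := by
    intro x
    split_ifs with h
    · obtain ⟨i, hi, hi'⟩ := nOcc_eq_one_iff.1 h.1
      obtain ⟨k, hk, hk'⟩ := nOcc_eq_one_iff.1 h.2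
      have hki : k ≠ i := fun e => huv (by rw [← hi, ← hk, e])
      have h1 : T i k x = 1 := Finset.prod_eq_one fun j _ => by
        by_cases hj : j = i
        · simp [hj, hi]
        by_cases hj' : j = k
        · subst hj'; simp [hj, hk]
        simp [hj, hj', hi' j hj, hk' j hj']
      rw [← h1]
      refine (Finset.single_le_sum (f := fun k => T i k x) (fun k _ => hT0 i k x)
        (Finset.mem_erase.2 ⟨hki, Finset.mem_univ k⟩)).trans ?_
      exact Finset.single_le_sum (f := fun i => ∑ k ∈ Finset.univ.erase i, T i k x)
        (fun i _ => Finset.sum_nonneg fun k _ => hT0 i k x) (Finset.mem_univ i)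
    · exact Finset.sum_nonneg fun i _ => Finset.sum_nonneg fun k _ => hT0 i k x
  have := integral_mono (hp.integrable_of_bounded (C := 1) fun x => by split_ifs <;> simp)
    (integrable_finsetSum _ fun i _ => integrable_finsetSum _ fun k _ => hint i k) hle
  rw [integral_finsetSum _ fun i _ => integrable_finsetSum _ fun k _ => hint i k,
    Finset.sum_congr rfl fun i _ => by
      rw [integral_finsetSum _ fun k _ => hint i k, Finset.sum_congr rfl (hval i)]] at this
  simpa [Finset.card_erase_of_mem] using this

end IsPMF

lemma one_sub_mul_pow_le {q : ℝ} (h0 : 0 ≤ q) (h1 : q ≤ 1) (m : ℕ) :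
    (1 - q) * q ^ m ≤ 1 / (m + 1) := by
  rw [le_div_iff₀ (by positivity)]
  have h : ((m + 1 : ℕ) : ℝ) * q ^ m ≤ ∑ k ∈ Finset.range (m + 1), q ^ k := by
    rw [← nsmul_eq_mul]
    simpa using Finset.card_nsmul_le_sum (Finset.range (m + 1)) (fun k => q ^ k) (q ^ m)
      fun k hk => pow_le_pow_of_le_one h0 h1 (Finset.mem_range_succ_iff.1 hk)
  have h' := mul_le_mul_of_nonneg_left h (sub_nonneg.2 h1)
  rw [mul_neg_geom_sum] at h'
  have := pow_nonneg h0 (m + 1)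
  push_cast at h'
  linarith

lemma goodTuring_mem_Icc {n : ℕ} (x : Fin n → ℕ) : goodTuring x ∈ Set.Icc (0 : ℝ) 1 := by
  refine ⟨by unfold goodTuring; positivity, div_le_one_of_le₀ ?_ (by positivity)⟩
  have : phi 1 x ≤ n :=
    (Finset.card_filter_le _ _).trans (Finset.card_image_le.trans (by simp))
  exact_mod_cast this

lemma hasSum_goodTuring {n : ℕ} (x : Fin n → ℕ) :
    HasSum (fun u => if nOcc x u = 1 then (n : ℝ)⁻¹ else 0) (goodTuring x) := by
  have h : ∀ u ∉ (Finset.univ.image x), (if nOcc x u = 1 then (n : ℝ)⁻¹ else 0) = 0 := by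
    intro u hu
    rw [if_neg]
    intro h
    obtain ⟨i, hi, -⟩ := nOcc_eq_one_iff.1 h
    exact hu (Finset.mem_image.2 ⟨i, Finset.mem_univ i, hi⟩)
  have : HasSum (fun u => if nOcc x u = 1 then (n : ℝ)⁻¹ else 0)
      (∑ u ∈ Finset.univ.image x, if nOcc x u = 1 then (n : ℝ)⁻¹ else 0) :=
    hasSum_sum_of_ne_finset_zero h
  rwa [← Finset.sum_filter, Finset.sum_const, nsmul_eq_mul, ← div_eq_mul_inv] at this

namespace IsPMF

variable {p : ℕ → ℝ} (hp : IsPMF p)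

include hp in
lemma summable_missingMass {n : ℕ} (x : Fin n → ℕ) :
    Summable fun u => if nOcc x u = 0 then p u else 0 :=
  Summable.of_nonneg_of_le (fun u => by split_ifs; exacts [hp.1 u, le_rfl])
    (fun u => by split_ifs; exacts [le_rfl, hp.1 u]) hp.2.summable

include hp in
lemma missingMass_mem_Icc {n : ℕ} (x : Fin n → ℕ) : missingMass p x ∈ Set.Icc (0 : ℝ) 1 := by
  have h0 : ∀ u, 0 ≤ if nOcc x u = 0 then p u else 0 := fun u => by
    split_ifs; exacts [hp.1 u, le_rfl]
  refine ⟨tsum_nonneg h0, ?_⟩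
  rw [← hp.2.tsum_eq]
  exact (hp.summable_missingMass x).tsum_le_tsum
    (fun u => by split_ifs; exacts [le_rfl, hp.1 u]) hp.2.summable

include hp in
lemma abs_sq_sub_missingMass_le {n : ℕ} {M : (Fin n → ℕ) → ℝ}
    (hM : ∀ x, M x ∈ Set.Icc (0 : ℝ) 1) (x : Fin n → ℕ) :
    |(M x - missingMass p x) ^ 2| ≤ 1 := by
  have h := hp.missingMass_mem_Icc x
  rw [abs_of_nonneg (sq_nonneg _), sq_le_one_iff_abs_le_one, abs_le]
  constructor <;> linarith [(hM x).1, (hM x).2, h.1, h.2]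

include hp in
lemma risk_le_one {n : ℕ} {M : (Fin n → ℕ) → ℝ} (hM : ∀ x, M x ∈ Set.Icc (0 : ℝ) 1) :
    risk n p M ≤ 1 := by
  rw [risk, hp.expct_eq_integral (hp.abs_sq_sub_missingMass_le hM)]
  calc _ ≤ ∫ _, (1 : ℝ) ∂hp.sampleLaw n :=
        integral_mono (hp.integrable_of_bounded (hp.abs_sq_sub_missingMass_le hM))
          (integrable_const _) fun x => (le_abs_self _).trans (hp.abs_sq_sub_missingMass_le hM x)
    _ = 1 := by simp

include hp in
lemma risk_nonneg {n : ℕ} (M : (Fin n → ℕ) → ℝ) : 0 ≤ risk n p M :=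
  tsum_nonneg fun _ => mul_nonneg (Finset.prod_nonneg fun _ _ => hp.1 _) (sq_nonneg _)

end IsPMF

/-- The contribution of the symbol `u` to the error of the Good-Turing estimator. -/
def gtError {n : ℕ} (p : ℕ → ℝ) (x : Fin n → ℕ) (u : ℕ) : ℝ :=
  (if nOcc x u = 1 then (n : ℝ)⁻¹ else 0) - if nOcc x u = 0 then p u else 0

namespace IsPMF

variable {p : ℕ → ℝ} (hp : IsPMF p)

include hp in
lemma hasSum_gtError {n : ℕ} (x : Fin n → ℕ) :
    HasSum (gtError p x) (goodTuring x - missingMass p x) :=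
  (hasSum_goodTuring x).sub (hp.summable_missingMass x).hasSum

include hp in
lemma abs_gtError_le {n : ℕ} (x : Fin n → ℕ) (u : ℕ) : |gtError p x u| ≤ 1 := by
  have hn : (n : ℝ)⁻¹ ≤ 1 := Nat.cast_inv_le_one n
  have hn0 : 0 ≤ (n : ℝ)⁻¹ := by positivity
  have := hp.1 u
  have := hp.le_one u
  unfold gtError
  rw [abs_le]
  constructor <;> split_ifs <;> linarith

include hp in
lemma abs_sum_gtError_le {n : ℕ} (x : Fin n → ℕ) (s : Finset ℕ) :
    |∑ u ∈ s, gtError p x u| ≤ 1 := by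
  unfold gtError
  rw [Finset.sum_sub_distrib]
  have h1 : ∑ u ∈ s, (if nOcc x u = 1 then (n : ℝ)⁻¹ else 0) ≤ 1 :=
    (sum_le_hasSum s (fun u _ => by split_ifs <;> positivity) (hasSum_goodTuring x)).trans
      (goodTuring_mem_Icc x).2
  have h2 : ∑ u ∈ s, (if nOcc x u = 0 then p u else 0) ≤ 1 :=
    (sum_le_hasSum s (fun u _ => by split_ifs; exacts [hp.1 u, le_rfl])
      (hp.summable_missingMass x).hasSum).trans (hp.missingMass_mem_Icc x).2
  have h3 : 0 ≤ ∑ u ∈ s, (if nOcc x u = 1 then (n : ℝ)⁻¹ else 0) :=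
    Finset.sum_nonneg fun u _ => by split_ifs <;> positivity
  have h4 : 0 ≤ ∑ u ∈ s, (if nOcc x u = 0 then p u else 0) :=
    Finset.sum_nonneg fun u _ => by split_ifs; exacts [hp.1 u, le_rfl]
  rw [abs_le]
  constructor <;> linarith

lemma integrable_indicator {n : ℕ} (P : (Fin n → ℕ) → Prop) [DecidablePred P] :
    Integrable (fun x => if P x then (1 : ℝ) else 0) (hp.sampleLaw n) :=
  hp.integrable_of_bounded (C := 1) fun x => by split_ifs <;> simp

lemma integral_gtError_sq_le {m : ℕ} (u : ℕ) :
    ∫ x, gtError p x u * gtError p x u ∂hp.sampleLaw (m + 2) ≤ 2 * p u / (m + 1) := by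
  have h : ∀ x : Fin (m + 2) → ℕ, gtError p x u * gtError p x u =
      (((m + 2 : ℕ) : ℝ)⁻¹) ^ 2 * (if nOcc x u = 1 then 1 else 0) +
        p u ^ 2 * (if nOcc x u = 0 then 1 else 0) := by
    intro x
    unfold gtError
    by_cases h1 : nOcc x u = 1
    · simp [h1, sq]
    · by_cases h0 : nOcc x u = 0
      · simp [h0]; ring
      · simp [h0, h1]
  simp_rw [h]
  rw [integral_add ((hp.integrable_indicator _).const_mul _)
    ((hp.integrable_indicator _).const_mul _), integral_const_mul, integral_const_mul,
    hp.integral_nOcc_eq_zero]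
  have hu := hp.1 u
  have hu1 := hp.le_one u
  have h1 : (((m + 2 : ℕ) : ℝ)⁻¹) ^ 2 * ∫ x, (if nOcc x u = 1 then (1 : ℝ) else 0)
      ∂hp.sampleLaw (m + 2) ≤ p u / (m + 1) := by
    refine (mul_le_mul_of_nonneg_left (hp.integral_nOcc_eq_one_le u) (by positivity)).trans ?_
    have : (((m + 2 : ℕ) : ℝ)⁻¹) ^ 2 * ((m + 2 : ℕ) * p u) = p u / (m + 2) := by
      push_cast; field_simp
    rw [this]
    gcongr
    norm_num
  have h2 : p u ^ 2 * (1 - p u) ^ (m + 2) ≤ p u / (m + 1) := by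
    have h3 := one_sub_mul_pow_le (sub_nonneg.2 hu1) (by linarith : 1 - p u ≤ 1) m
    rw [sub_sub_cancel] at h3
    have h4 : (1 - p u) ^ (m + 2) ≤ (1 - p u) ^ m :=
      pow_le_pow_of_le_one (sub_nonneg.2 hu1) (by linarith) (by omega)
    calc p u ^ 2 * (1 - p u) ^ (m + 2) ≤ p u ^ 2 * (1 - p u) ^ m := by gcongr
      _ = p u * (p u * (1 - p u) ^ m) := by ring
      _ ≤ p u * (1 / (m + 1)) := by gcongr
      _ = p u / (m + 1) := by ring
  calc _ ≤ p u / (m + 1) + p u / (m + 1) := add_le_add h1 h2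
    _ = 2 * p u / (m + 1) := by ring

lemma integral_gtError_mul_le {m : ℕ} {u v : ℕ} (huv : u ≠ v) :
    ∫ x, gtError p x u * gtError p x v ∂hp.sampleLaw (m + 2) ≤ p u * p v / (m + 1) := by
  set N : ℝ := ((m + 2 : ℕ) : ℝ) with hN
  have h : ∀ x : Fin (m + 2) → ℕ, gtError p x u * gtError p x v =
      (N⁻¹ ^ 2 * (if nOcc x u = 1 ∧ nOcc x v = 1 then 1 else 0) +
        p u * p v * (if nOcc x u = 0 ∧ nOcc x v = 0 then 1 else 0)) -
      (N⁻¹ * p u * (if nOcc x u = 0 ∧ nOcc x v = 1 then 1 else 0) +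
        N⁻¹ * p v * (if nOcc x v = 0 ∧ nOcc x u = 1 then 1 else 0)) := by
    intro x
    unfold gtError
    rw [← hN]
    by_cases hu1 : nOcc x u = 1 <;> by_cases hv1 : nOcc x v = 1 <;>
      by_cases hu0 : nOcc x u = 0 <;> by_cases hv0 : nOcc x v = 0 <;>
      simp [hu1, hv1, hu0, hv0] <;> first | omega | ring
  simp_rw [h]
  have hi := fun (c : ℝ) (P : (Fin (m + 2) → ℕ) → Prop) [DecidablePred P] =>
    (hp.integrable_indicator P).const_mul c
  have hi₂ := fun (c d : ℝ) (P Q : (Fin (m + 2) → ℕ) → Prop) [DecidablePred P] [DecidablePred Q] =>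
    show Integrable (fun x => c * (if P x then (1 : ℝ) else 0) + d * (if Q x then 1 else 0))
      (hp.sampleLaw (m + 2)) from (hi c P).add (hi d Q)
  rw [integral_sub (hi₂ _ _ _ _) (hi₂ _ _ _ _), integral_add (hi _ _) (hi _ _),
    integral_add (hi _ _) (hi _ _)]
  simp only [integral_const_mul]
  rw [hp.integral_nOcc_zero_zero huv]
  have h11 := hp.integral_nOcc_one_one_le (n := m + 2) huv
  have h01 := hp.le_integral_nOcc_zero_one (n := m + 2) huv
  have h10 := hp.le_integral_nOcc_zero_one (n := m + 2) huv.symm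
  have hu := hp.1 u
  have hv := hp.1 v
  have hq0 : p u + p v ≤ 1 := by simpa [Finset.sum_pair huv] using hp.sum_le_one {u, v}
  rw [show 1 - p v - p u = 1 - p u - p v by ring] at h10
  set q := 1 - p u - p v with hq
  rw [← hN] at h11 h01 h10
  have hNpos : 0 < N := by positivity
  have hN1 : ((m + 2 - 1 : ℕ) : ℝ) = N - 1 := by rw [hN]; push_cast; ring
  rw [hN1] at h11
  simp only [show m + 2 - 2 = m by omega] at h11
  simp only [show m + 2 - 1 = m + 1 by omega] at h01 h10
  have b11 := mul_le_mul_of_nonneg_left h11 (by positivity : 0 ≤ N⁻¹ ^ 2)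
  have b01 := mul_le_mul_of_nonneg_left h01 (by positivity : 0 ≤ N⁻¹ * p u)
  have b10 := mul_le_mul_of_nonneg_left h10 (by positivity : 0 ≤ N⁻¹ * p v)
  have e11 : N⁻¹ ^ 2 * (N * ((N - 1) * (p u * p v * q ^ m))) =
      p u * p v * q ^ m - N⁻¹ * (p u * p v * q ^ m) := by field_simp
  have e01 : N⁻¹ * p u * (N * (p v * q ^ (m + 1))) = p u * p v * q ^ (m + 1) := by field_simp
  have e10 : N⁻¹ * p v * (N * (p u * q ^ (m + 1))) = p u * p v * q ^ (m + 1) := by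
    field_simp
  rw [e11] at b11
  rw [e01] at b01
  rw [e10] at b10
  have hq0' : 0 ≤ q := by rw [hq]; linarith
  have hq1 : q ≤ 1 := by rw [hq]; linarith
  have hpos : 0 ≤ N⁻¹ * (p u * p v * q ^ m) := by positivity
  have hg : p u * p v * ((1 - q) ^ 2 * q ^ m) ≤ p u * p v / (m + 1) := by
    have h1 : (1 - q) ^ 2 * q ^ m ≤ 1 / (m + 1) := by
      refine le_trans ?_ (one_sub_mul_pow_le hq0' hq1 m)
      gcongr
      nlinarith
    calc _ ≤ p u * p v * (1 / (m + 1)) := by gcongr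
      _ = _ := by ring
  have e : p u * p v * ((1 - q) ^ 2 * q ^ m) =
      p u * p v * q ^ m - 2 * (p u * p v * q ^ (m + 1)) + p u * p v * q ^ (m + 2) := by ring
  linarith

include hp in
lemma integral_sum_gtError_sq_le {m : ℕ} (s : Finset ℕ) :
    ∫ x, (∑ u ∈ s, gtError p x u) ^ 2 ∂hp.sampleLaw (m + 2) ≤ 3 / (m + 1) := by
  have hint : ∀ u v, Integrable (fun x => gtError p x u * gtError p x v)
      (hp.sampleLaw (m + 2)) := fun u v => hp.integrable_of_bounded (C := 1) fun x => by
    rw [abs_mul]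
    exact mul_le_one₀ (hp.abs_gtError_le x u) (abs_nonneg _) (hp.abs_gtError_le x v)
  simp_rw [sq, Finset.sum_mul_sum]
  rw [integral_finsetSum _ fun u _ => integrable_finsetSum _ fun v _ => hint u v]
  simp_rw [integral_finsetSum _ fun v _ => hint _ v]
  have hpair : ∀ u v, ∫ x, gtError p x u * gtError p x v ∂hp.sampleLaw (m + 2) ≤
      (if u = v then 2 * p u / (m + 1) else 0) + p u * p v / (m + 1) := by
    intro u v
    have := hp.1 u
    have := hp.1 v
    split_ifs with h
    · subst h
      exact (hp.integral_gtError_sq_le u).trans (le_add_of_nonneg_right (by positivity))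
    · simpa using hp.integral_gtError_mul_le h
  have hs := hp.sum_le_one s
  have hs0 : 0 ≤ ∑ u ∈ s, p u := Finset.sum_nonneg fun u _ => hp.1 u
  calc _ ≤ ∑ u ∈ s, ∑ v ∈ s,
        ((if u = v then 2 * p u / (m + 1) else 0) + p u * p v / (m + 1)) :=
        Finset.sum_le_sum fun u _ => Finset.sum_le_sum fun v _ => hpair u v
    _ = (2 * (∑ u ∈ s, p u) + (∑ u ∈ s, p u) * ∑ v ∈ s, p v) / (m + 1) := by
        simp_rw [Finset.sum_add_distrib, Finset.sum_ite_eq]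
        rw [Finset.sum_ite_mem, Finset.inter_self, add_div, Finset.mul_sum, Finset.sum_mul_sum,
          Finset.sum_div, Finset.sum_div]
        simp_rw [Finset.sum_div]
    _ ≤ 3 / (m + 1) := by gcongr; nlinarith

include hp in
/-- The Good-Turing estimator has risk `O(1/n)`, uniformly in `p`. -/
lemma risk_goodTuring_le (m : ℕ) : risk (m + 2) p goodTuring ≤ 3 / (m + 1) := by
  rw [risk, hp.expct_eq_integral (hp.abs_sq_sub_missingMass_le goodTuring_mem_Icc)]
  refine le_of_tendsto (tendsto_integral_of_dominated_convergence
    (F := fun K x => (∑ u ∈ Finset.range K, gtError p x u) ^ 2) (fun _ => 1)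
    (fun K => (measurable_of_countable _).aestronglyMeasurable) (integrable_const _)
    (fun K => Eventually.of_forall fun x => ?_) (Eventually.of_forall fun x =>
      ((hp.hasSum_gtError x).tendsto_sum_nat).pow 2))
    (Eventually.of_forall fun K => hp.integral_sum_gtError_sq_le _)
  rw [Real.norm_eq_abs, abs_of_nonneg (sq_nonneg _), sq_le_one_iff_abs_le_one]
  exact hp.abs_sum_gtError_le x _

end IsPMF

lemma bddAbove_risk {n : ℕ} {M : (Fin n → ℕ) → ℝ} (hM : ∀ x, M x ∈ Set.Icc (0 : ℝ) 1) :
    BddAbove {s : ℝ | ∃ p : ℕ → ℝ, IsPMF p ∧ s = risk n p M} :=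
  ⟨1, by rintro _ ⟨p, hp, rfl⟩; exact hp.risk_le_one hM⟩

lemma minimaxRisk_le (m : ℕ) : minimaxRisk (m + 2) ≤ 3 / (m + 1) := by
  have hbdd : BddBelow {r : ℝ | ∃ M : (Fin (m + 2) → ℕ) → ℝ, (∀ x, M x ∈ Set.Icc (0 : ℝ) 1) ∧
      r = sSup {s : ℝ | ∃ p : ℕ → ℝ, IsPMF p ∧ s = risk (m + 2) p M}} := by
    refine ⟨0, ?_⟩
    rintro _ ⟨M, -, rfl⟩
    exact Real.sSup_nonneg (by rintro _ ⟨p, hp, rfl⟩; exact hp.risk_nonneg M)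
  refine (csInf_le hbdd ⟨goodTuring, goodTuring_mem_Icc, rfl⟩).trans ?_
  refine Real.sSup_le ?_ (by positivity)
  rintro _ ⟨p, hp, rfl⟩
  exact hp.risk_goodTuring_le m

section FiniteAlphabet

variable {n K : ℕ}

/-- The number of appearances of the symbol `u` in a sample from the alphabet `Fin K`. -/
def finOcc (x : Fin n → Fin K) (u : Fin K) : ℕ := nOcc (fun i => (x i : ℕ)) u

lemma finOcc_eq_card (x : Fin n → Fin K) (u : Fin K) :
    finOcc x u = (Finset.univ.filter fun i => x i = u).card := by
  simp [finOcc, nOcc, Fin.val_inj]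

lemma prod_comp_eq_prod_pow_finOcc (g : Fin K → ℝ) (x : Fin n → Fin K) :
    ∏ i, g (x i) = ∏ u, g u ^ finOcc x u := by
  rw [← Finset.prod_fiberwise Finset.univ x fun i => g (x i)]
  refine Finset.prod_congr rfl fun u _ => ?_
  rw [finOcc_eq_card, ← Finset.prod_const]
  exact Finset.prod_congr rfl fun i hi => by rw [(Finset.mem_filter.1 hi).2]

lemma sum_finOcc (x : Fin n → Fin K) : ∑ u, finOcc x u = n := by
  simp_rw [finOcc_eq_card]
  rw [← Finset.card_eq_sum_card_fiberwise fun i _ => Finset.mem_univ (x i)]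
  simp

lemma le_card_unseen_add (x : Fin n → Fin K) :
    K ≤ (Finset.univ.filter fun u => finOcc x u = 0).card + n := by
  have h1 : (Finset.univ.filter fun u => ¬ finOcc x u = 0) ⊆ Finset.univ.image x := by
    intro u hu
    rw [Finset.mem_filter, finOcc_eq_card, Finset.card_eq_zero,
      Finset.filter_eq_empty_iff] at hu
    push Not at hu
    obtain ⟨-, i, hi, h⟩ := hu
    exact Finset.mem_image.2 ⟨i, hi, h⟩
  have h2 : (Finset.univ.filter fun u => ¬ finOcc x u = 0).card ≤ n :=
    (Finset.card_le_card h1).trans (Finset.card_image_le.trans (by simp))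
  have h3 := Finset.card_filter_add_card_filter_not (s := (Finset.univ : Finset (Fin K)))
    fun u => finOcc x u = 0
  rw [Finset.card_univ, Fintype.card_fin] at h3
  omega

/-- The masses on `ℕ` that extend masses on `Fin K` by zero. -/
def extendMass (q : Fin K → ℝ) : ℕ → ℝ := Function.extend Fin.val q 0

lemma extendMass_val (q : Fin K → ℝ) (u : Fin K) : extendMass q u = q u :=
  Fin.val_injective.extend_apply q _ u

lemma extendMass_eq_zero (q : Fin K → ℝ) {u : ℕ} (hu : u ∉ Set.range (Fin.val : Fin K → ℕ)) :
    extendMass q u = 0 :=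
  Function.extend_apply' q _ u hu

lemma isPMF_extendMass {q : Fin K → ℝ} (hq : ∀ u, 0 ≤ q u) (hsum : ∑ u, q u = 1) :
    IsPMF (extendMass q) := by
  constructor
  · intro u
    by_cases hu : u ∈ Set.range (Fin.val : Fin K → ℕ)
    · obtain ⟨v, rfl⟩ := hu
      rw [extendMass_val]
      exact hq v
    · rw [extendMass_eq_zero q hu]
  · exact hasSum_extend_zero Fin.val_injective |>.2 (hsum ▸ hasSum_fintype q)

lemma missingMass_extendMass (q : Fin K → ℝ) (x : Fin n → Fin K) :
    missingMass (extendMass q) (fun i => (x i : ℕ)) =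
      ∑ u, if finOcc x u = 0 then q u else 0 := by
  rw [missingMass, ← Fin.val_injective.tsum_eq (f := fun u =>
    if nOcc (fun i => (x i : ℕ)) u = 0 then extendMass q u else 0), tsum_fintype]
  · exact Finset.sum_congr rfl fun u _ => by rw [extendMass_val, finOcc]
  · intro u hu
    by_contra h
    exact hu (by simp [extendMass_eq_zero q h])

lemma risk_extendMass (q : Fin K → ℝ) (M : (Fin n → ℕ) → ℝ) :
    risk n (extendMass q) M = ∑ x : Fin n → Fin K, (∏ i, q (x i)) *
      (M (fun i => (x i : ℕ)) - ∑ u, if finOcc x u = 0 then q u else 0) ^ 2 := by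
  have hinj : Function.Injective fun (x : Fin n → Fin K) (i : Fin n) => (x i : ℕ) :=
    fun x y h => funext fun i => Fin.val_injective (congrFun h i)
  rw [risk, expct, ← hinj.tsum_eq, tsum_fintype]
  · refine Finset.sum_congr rfl fun x _ => ?_
    simp only [sampleProb, extendMass_val, missingMass_extendMass]
  · intro x hx
    have h : ∀ i, x i ∈ Set.range (Fin.val : Fin K → ℕ) := by
      intro i
      by_contra h
      refine hx ?_
      simp only
      rw [sampleProb, Finset.prod_eq_zero (Finset.mem_univ i) (extendMass_eq_zero q h), zero_mul]
    choose y hy using h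
    exact ⟨y, funext hy⟩

/-- A homogeneous form of the risk bound `R`, in terms of unnormalized masses `g`. -/
lemma sum_prod_mul_sq_le {M : (Fin n → ℕ) → ℝ} {R : ℝ} (hR : ∀ p, IsPMF p → risk n p M ≤ R)
    {g : Fin K → ℝ} (hg : ∀ u, 0 ≤ g u) (hS : 0 < ∑ u, g u) :
    ∑ x : Fin n → Fin K, (∏ i, g (x i)) *
      (∑ u, (M (fun i => (x i : ℕ)) - if finOcc x u = 0 then 1 else 0) * g u) ^ 2 ≤
      R * ∑ x : Fin n → Fin K, (∏ i, g (x i)) * (∑ u, g u) ^ 2 := by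
  set S := ∑ u, g u with hSdef
  have h := hR _ (isPMF_extendMass (q := fun u => g u / S) (fun u => div_nonneg (hg u) hS.le)
    (by rw [← Finset.sum_div, div_self hS.ne']))
  rw [risk_extendMass] at h
  have hpow : ∑ x : Fin n → Fin K, (∏ i, g (x i)) = S ^ n := by
    rw [← Fintype.piFinset_univ, ← Finset.prod_univ_sum]
    simp [hSdef]
  rw [← Finset.sum_mul, hpow]
  have h' := mul_le_mul_of_nonneg_right h (by positivity : 0 ≤ S ^ n * S ^ 2)
  refine le_trans (le_of_eq ?_) h'
  rw [Finset.sum_mul]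
  refine Finset.sum_congr rfl fun x _ => ?_
  have e : ∑ u, (M (fun i => (x i : ℕ)) - if finOcc x u = 0 then 1 else 0) * g u =
      S * (M (fun i => (x i : ℕ)) - ∑ u, if finOcc x u = 0 then g u / S else 0) := by
    simp_rw [sub_mul, Finset.sum_sub_distrib, ← Finset.mul_sum]
    rw [← hSdef, mul_sub, mul_comm S]
    refine congrArg _ ?_
    rw [Finset.mul_sum]
    refine Finset.sum_congr rfl fun u _ => ?_
    split_ifs
    · field_simp
    · simp
  rw [e, Finset.prod_div_distrib, Finset.prod_const, Finset.card_univ, Fintype.card_fin]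
  field_simp

end FiniteAlphabet

section GammaPrior

/-- The unnormalized density of the Gamma distribution with shape `α` and rate `1`. -/
def gammaWeight (α t : ℝ) : ℝ := (Set.Ioi 0).indicator (fun t => Real.exp (-t) * t ^ (α - 1)) t

lemma gammaWeight_nonneg (α t : ℝ) : 0 ≤ gammaWeight α t :=
  Set.indicator_nonneg (fun t (ht : 0 < t) => by positivity) t

lemma gammaWeight_of_nonpos (α : ℝ) {t : ℝ} (ht : t ≤ 0) : gammaWeight α t = 0 :=
  Set.indicator_of_notMem (by simpa using ht) _

lemma pow_mul_gammaWeight (α : ℝ) (k : ℕ) :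
    (fun t => t ^ k * gammaWeight α t) =
      (Set.Ioi 0).indicator fun t => Real.exp (-t) * t ^ (α + k - 1) := by
  ext t
  unfold gammaWeight
  by_cases ht : t ∈ Set.Ioi (0 : ℝ)
  · rw [Set.indicator_of_mem ht, Set.indicator_of_mem ht,
      show α + k - 1 = (α - 1) + k by ring, Real.rpow_add_natCast (ne_of_gt ht)]
    ring
  · rw [Set.indicator_of_notMem ht, Set.indicator_of_notMem ht, mul_zero]

variable {α : ℝ} (hα : 0 < α)

include hα in
lemma integrable_pow_mul_gammaWeight (k : ℕ) : Integrable fun t => t ^ k * gammaWeight α t := by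
  rw [pow_mul_gammaWeight, integrable_indicator_iff measurableSet_Ioi]
  exact Real.GammaIntegral_convergent (by positivity)

include hα in
lemma integral_pow_mul_gammaWeight (k : ℕ) :
    ∫ t, t ^ k * gammaWeight α t = Real.Gamma (α + k) := by
  rw [pow_mul_gammaWeight, integral_indicator measurableSet_Ioi,
    Real.Gamma_eq_integral (by positivity)]

variable {ι : Type*} [Fintype ι] [DecidableEq ι]

/-- The mixed moments of independent Gamma variables, up to a common factor. -/
def gammaMoment (α : ℝ) (k : ι → ℕ) : ℝ := ∏ u, Real.Gamma (α + k u)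

include hα in
omit [DecidableEq ι] in
lemma gammaMoment_pos (k : ι → ℕ) : 0 < gammaMoment α k :=
  Finset.prod_pos fun _ _ => Real.Gamma_pos_of_pos (by positivity)

include hα in
lemma gammaMoment_add_single (k : ι → ℕ) (u : ι) :
    gammaMoment α (k + Pi.single u 1) = (α + k u) * gammaMoment α k := by
  unfold gammaMoment
  rw [← Finset.mul_prod_erase _ _ (Finset.mem_univ u),
    ← Finset.mul_prod_erase (a := u) _ (fun u => Real.Gamma (α + k u)) (Finset.mem_univ u),
    ← mul_assoc]
  congr 1
  · rw [← Real.Gamma_add_one (by positivity)]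
    simp [add_assoc]
  · refine Finset.prod_congr rfl fun v hv => ?_
    simp [Finset.ne_of_mem_erase hv]

include hα in
omit [DecidableEq ι] in
lemma integrable_prod_pow_mul_gammaWeight (k : ι → ℕ) :
    Integrable fun g : ι → ℝ => (∏ u, g u ^ k u) * ∏ u, gammaWeight α (g u) := by
  simp_rw [← Finset.prod_mul_distrib]
  exact Integrable.fintype_prod (f := fun u t => t ^ k u * gammaWeight α t)
    fun u => integrable_pow_mul_gammaWeight hα (k u)

include hα in
omit [DecidableEq ι] in
lemma integral_prod_pow_mul_gammaWeight (k : ι → ℕ) :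
    ∫ g : ι → ℝ, (∏ u, g u ^ k u) * ∏ u, gammaWeight α (g u) = gammaMoment α k := by
  simp_rw [← Finset.prod_mul_distrib]
  rw [integral_fintype_prod_volume_eq_prod fun u t => t ^ k u * gammaWeight α t]
  exact Finset.prod_congr rfl fun u _ => integral_pow_mul_gammaWeight hα (k u)

lemma prod_pow_mul_sq_expand (α : ℝ) (k : ι → ℕ) (r g : ι → ℝ) :
    (∏ u, g u ^ k u) * (∑ u, r u * g u) ^ 2 * ∏ u, gammaWeight α (g u) =
      ∑ u, ∑ v, r u * r v * ((∏ w, g w ^ (k + Pi.single u 1 + Pi.single v 1 : ι → ℕ) w) *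
        ∏ w, gammaWeight α (g w)) := by
  have hs : ∀ u, ∏ w, g w ^ (Pi.single u 1 : ι → ℕ) w = g u := by
    intro u
    rw [Finset.prod_eq_single u] <;> simp +contextual
  simp_rw [Pi.add_apply, pow_add, Finset.prod_mul_distrib, hs, sq, Finset.sum_mul_sum,
    Finset.mul_sum, Finset.sum_mul]
  exact Finset.sum_congr rfl fun u _ => Finset.sum_congr rfl fun v _ => by ring

include hα in
lemma integrable_prod_pow_mul_sq (k : ι → ℕ) (r : ι → ℝ) :
    Integrable fun g : ι → ℝ =>
      (∏ u, g u ^ k u) * (∑ u, r u * g u) ^ 2 * ∏ u, gammaWeight α (g u) := by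
  simp_rw [prod_pow_mul_sq_expand]
  exact integrable_finsetSum _ fun u _ => integrable_finsetSum _ fun v _ =>
    (integrable_prod_pow_mul_gammaWeight hα _).const_mul _

include hα in
/-- Second moments of linear forms under a tilted product of Gamma distributions. -/
lemma integral_prod_pow_mul_sq (k : ι → ℕ) (r : ι → ℝ) :
    ∫ g : ι → ℝ, (∏ u, g u ^ k u) * (∑ u, r u * g u) ^ 2 * ∏ u, gammaWeight α (g u) =
      gammaMoment α k * ((∑ u, r u * (α + k u)) ^ 2 + ∑ u, r u ^ 2 * (α + k u)) := by
  simp_rw [prod_pow_mul_sq_expand]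
  have hint := fun (u v : ι) => (integrable_prod_pow_mul_gammaWeight hα
    (k + Pi.single u 1 + Pi.single v 1)).const_mul (r u * r v)
  rw [integral_finsetSum _ fun u _ => integrable_finsetSum _ fun v _ => hint u v]
  simp_rw [integral_finsetSum _ fun v _ => hint _ v, integral_const_mul,
    integral_prod_pow_mul_gammaWeight hα, gammaMoment_add_single hα]
  have e : ∀ u v, r u * r v * ((α + ((k + Pi.single u 1 : ι → ℕ) v : ℕ)) *
      ((α + k u) * gammaMoment α k)) = gammaMoment α k * ((r u * (α + k u)) * (r v * (α + k v))) +
      if u = v then gammaMoment α k * (r u ^ 2 * (α + k u)) else 0 := by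
    intro u v
    split_ifs with h
    · subst h
      simp only [Pi.add_apply, Pi.single_eq_same]
      push_cast
      ring
    · simp only [Pi.add_apply, Pi.single_eq_of_ne (Ne.symm h), add_zero]
      ring
  simp_rw [e, Finset.sum_add_distrib, Finset.sum_ite_eq, Finset.mem_univ, if_true]
  rw [mul_add, sq, Finset.sum_mul_sum, Finset.mul_sum, Finset.mul_sum]
  simp_rw [Finset.mul_sum]

end GammaPrior

/-- The Bayes risk bound for Gamma weights with shape `α` on an alphabet of size `K`. -/
lemma le_mul_of_forall_risk_le {n K : ℕ} (hn : 0 < n) (hnK : n ≤ K) {M : (Fin n → ℕ) → ℝ} {R : ℝ}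
    (hR : ∀ p, IsPMF p → risk n p M ≤ R) {α T : ℝ} (hα : 0 < α) (hT : T = α * K + n) :
    α * (K - n) * n / T ≤ R * (T ^ 2 + T) := by
  have hK : 0 < K := hn.trans_le hnK
  have hTpos : 0 < T := by rw [hT]; positivity
  let r : (Fin n → Fin K) → Fin K → ℝ := fun x u =>
    M (fun i => (x i : ℕ)) - if finOcc x u = 0 then 1 else 0
  have hpt : ∀ g : Fin K → ℝ,
      ∑ x : Fin n → Fin K, (∏ u, g u ^ finOcc x u) * (∑ u, r x u * g u) ^ 2 *
        ∏ u, gammaWeight α (g u) ≤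
      R * ∑ x : Fin n → Fin K, (∏ u, g u ^ finOcc x u) * (∑ u, 1 * g u) ^ 2 *
        ∏ u, gammaWeight α (g u) := by
    intro g
    by_cases hg : ∀ u, 0 < g u
    · have hS : 0 < ∑ u, g u :=
        Finset.sum_pos (fun u _ => hg u) ⟨⟨0, hK⟩, Finset.mem_univ _⟩
      have h := sum_prod_mul_sq_le hR (fun u => (hg u).le) hS
      have h' := mul_le_mul_of_nonneg_right h
        (Finset.prod_nonneg fun u _ => gammaWeight_nonneg α (g u) :
          0 ≤ ∏ u, gammaWeight α (g u))
      simpa only [prod_comp_eq_prod_pow_finOcc, Finset.sum_mul, mul_assoc, one_mul] using h'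
    · push Not at hg
      obtain ⟨u, hu⟩ := hg
      have h0 : ∏ u, gammaWeight α (g u) = 0 :=
        Finset.prod_eq_zero (Finset.mem_univ u) (gammaWeight_of_nonpos α hu)
      simp [h0]
  have hi := fun (x : Fin n → Fin K) (r : Fin K → ℝ) =>
    integrable_prod_pow_mul_sq hα (finOcc x) r
  have hineq := integral_mono (integrable_finsetSum _ fun x _ => hi x (r x))
    ((integrable_finsetSum _ fun x _ => hi x fun _ => 1).const_mul R) hpt
  rw [integral_const_mul, integral_finsetSum _ fun x _ => hi x (r x),
    integral_finsetSum _ fun x _ => hi x fun _ => 1] at hineq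
  simp_rw [integral_prod_pow_mul_sq hα] at hineq
  have hc : ∀ x : Fin n → Fin K, ∑ u, (α + finOcc x u) = T := by
    intro x
    rw [Finset.sum_add_distrib, ← Nat.cast_sum, sum_finOcc, hT]
    simp [mul_comm]
  have hlow : ∀ x : Fin n → Fin K, α * (K - n) * n / T ≤
      (∑ u, r x u * (α + finOcc x u)) ^ 2 + ∑ u, r x u ^ 2 * (α + finOcc x u) := by
    intro x
    set m := M (fun i => (x i : ℕ)) with hm
    set a : ℝ := α * (Finset.univ.filter fun u => finOcc x u = 0).card with ha
    have hz : ∑ u, (if finOcc x u = 0 then (1 : ℝ) else 0) * (α + finOcc x u) = a := by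
      rw [ha, mul_comm, ← nsmul_eq_mul, ← Finset.sum_const, Finset.sum_filter]
      refine Finset.sum_congr rfl fun u _ => ?_
      split_ifs with h <;> simp [h]
    have h1 : ∑ u, r x u * (α + finOcc x u) = m * T - a := by
      simp only [r, sub_mul, Finset.sum_sub_distrib, ← Finset.mul_sum, hc, hz, ← hm]
    have h2 : ∑ u, r x u ^ 2 * (α + finOcc x u) = m ^ 2 * T - 2 * m * a + a := by
      rw [← hc x, ← hz, Finset.mul_sum, Finset.mul_sum, ← Finset.sum_sub_distrib,
        ← Finset.sum_add_distrib]
      refine Finset.sum_congr rfl fun u _ => ?_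
      simp only [r, ← hm]
      split_ifs <;> ring
    rw [h1, h2, div_le_iff₀ hTpos]
    have hcard := le_card_unseen_add x
    have hcard' : (Finset.univ.filter fun u => finOcc x u = 0).card ≤ K :=
      (Finset.card_filter_le _ _).trans (by simp)
    have ha1 : α * (K - n) ≤ a := by
      rw [ha]
      gcongr
      rw [sub_le_iff_le_add]
      exact_mod_cast hcard
    have ha2 : a ≤ α * K := by
      rw [ha]
      gcongr
    have ha0 : 0 ≤ a := by positivity
    have key : α * (K - n) * n ≤ a * (T - a) :=
      mul_le_mul ha1 (by linarith) (by positivity) ha0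
    have := mul_nonneg (by positivity : 0 ≤ T + 1) (sq_nonneg (m * T - a))
    nlinarith
  have hw : 0 < ∑ x : Fin n → Fin K, gammaMoment α (finOcc x) :=
    Finset.sum_pos (fun x _ => gammaMoment_pos hα _) ⟨fun _ => ⟨0, hK⟩, Finset.mem_univ _⟩
  simp only [one_mul, one_pow, hc, ← Finset.sum_mul] at hineq
  refine le_of_mul_le_mul_left ?_ hw
  calc _ = ∑ x : Fin n → Fin K, gammaMoment α (finOcc x) * (α * (K - n) * n / T) := by
        rw [Finset.sum_mul]
    _ ≤ _ := Finset.sum_le_sum fun x _ =>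
        mul_le_mul_of_nonneg_left (hlow x) (gammaMoment_pos hα _).le
    _ ≤ _ := hineq
    _ = _ := by ring

lemma le_mul_minimaxRisk {n : ℕ} (hn : 0 < n) :
    4 / 27 - 8 / 27 / (n : ℝ) ≤ n * minimaxRisk n := by
  have hn' : (1 : ℝ) ≤ n := by exact_mod_cast hn
  have hn0 : (0 : ℝ) < n := by positivity
  rw [← div_le_iff₀' hn0]
  refine le_csInf ⟨_, goodTuring, goodTuring_mem_Icc, rfl⟩ ?_
  rintro _ ⟨M, hM, rfl⟩
  set R := sSup {s : ℝ | ∃ p : ℕ → ℝ, IsPMF p ∧ s = risk n p M}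
  have h := le_mul_of_forall_risk_le (K := n ^ 2) (R := R) hn (Nat.le_self_pow two_ne_zero n)
    (fun p hp => le_csSup (bddAbove_risk hM) ⟨p, hp, rfl⟩)
    (α := 1 / (2 * n)) (T := 3 * n / 2) (by positivity) (by push_cast; field_simp; norm_num)
  have e : 1 / (2 * (n : ℝ)) * ((n ^ 2 : ℕ) - n) * n / (3 * n / 2) = (n - 1) / 3 := by
    push_cast; field_simp
  rw [e] at h
  rw [div_le_iff₀ hn0]
  have h2 : 4 * (n - 1) / (27 * n + 18) ≤ R * n := by
    rw [div_le_iff₀ (by positivity)]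
    nlinarith
  refine le_trans ?_ h2
  rw [le_div_iff₀ (by positivity)]
  field_simp
  nlinarith

/-- **Lemma 6 (Dirichlet-prior lower bound):**
the minimax risk of missing mass estimation satisfies
`liminf_{n→∞} n · R*_n ≥ 4/27`. -/
theorem minimax_risk_liminf_ge_four_div_27 :
    4 / 27 ≤ Filter.liminf (fun n : ℕ => (n : ℝ) * minimaxRisk n) Filter.atTop := by
  have hlim : Tendsto (fun n : ℕ => (4 / 27 : ℝ) - 8 / 27 / (n : ℝ)) atTop (𝓝 (4 / 27)) := by
    simpa using tendsto_const_nhds.sub (tendsto_const_div_atTop_nhds_zero_nat (8 / 27 : ℝ))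
  rw [← hlim.liminf_eq]
  refine liminf_le_liminf ?_ hlim.isBoundedUnder_ge ?_
  · filter_upwards [eventually_gt_atTop 0] with n hn
    exact le_mul_minimaxRisk hn
  · refine isCoboundedUnder_ge_of_eventually_le _ (x := 6) ?_
    filter_upwards [eventually_ge_atTop 2] with n hn
    obtain ⟨m, rfl⟩ := Nat.exists_eq_add_of_le' hn
    refine (mul_le_mul_of_nonneg_left (minimaxRisk_le m) (by positivity)).trans ?_
    rw [mul_div_assoc', div_le_iff₀ (by positivity)]
    push_cast
    have : (0 : ℝ) ≤ m := by positivity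
    linarith
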